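/- Let κ > 0 and μ ∈ {+1,−1}, and set Λ(ξ) = (d₂(ξ) + μ·d₁(ξ))/2 (so Λ = Σ_κ for μ = +1 and Λ = Ω_κ for μ = −1). Then Λ is infinitely differentiable on ℝ³ ∖ {(0,0,κ⁻¹), (0,0,−κ⁻¹)}, and for every ξ = (ξ₁,ξ₂,ξ₃) in this set the 3×3 matrix H(ξ) of second partial derivatives, H_{ij}(ξ) = ∂_{ξ_i}∂_{ξ_j}Λ(ξ), satisfies det H(ξ) = κ⁻²·(ξ₁² + ξ₂²)·Λ(ξ)/(d₁(ξ)·d₂(ξ))⁴. -/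

import Mathlib

noncomputable section

/-- `ℝ³` with the Euclidean norm. -/
abbrev E3 : Type := EuclideanSpace ℝ (Fin 3)

/-- `d₁(ξ)`, the distance from `ξ` to `(0,0,κ⁻¹)`. -/
def d1 (κ : ℝ) (ξ : E3) : ℝ := Real.sqrt ((ξ 0) ^ 2 + (ξ 1) ^ 2 + (ξ 2 - κ⁻¹) ^ 2)

/-- `d₂(ξ)`, the distance from `ξ` to `(0,0,−κ⁻¹)`. -/
def d2 (κ : ℝ) (ξ : E3) : ℝ := Real.sqrt ((ξ 0) ^ 2 + (ξ 1) ^ 2 + (ξ 2 + κ⁻¹) ^ 2)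

/-- The partial derivative of `f : ℝ³ → ℝ` in the `i`-th coordinate direction. -/
def pd (i : Fin 3) (f : E3 → ℝ) (ξ : E3) : ℝ :=
  fderiv ℝ f ξ (EuclideanSpace.single i (1 : ℝ))

open Filter Topology in
theorem pd_congr_of_eventuallyEq {f g : E3 → ℝ} {ξ : E3} (i : Fin 3) (h : f =ᶠ[𝓝 ξ] g) :
    pd i f ξ = pd i g ξ := by
  rw [pd, pd, h.fderiv_eq]

theorem hasFDerivAt_norm_sub {p ξ : E3} (h : ξ ≠ p) :
    HasFDerivAt (fun η : E3 => ‖η - p‖) (‖ξ - p‖⁻¹ • innerSL ℝ (ξ - p)) ξ := by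
  have hn : ‖ξ - p‖ ≠ 0 := norm_ne_zero_iff.mpr (sub_ne_zero.mpr h)
  have h1 := (((hasFDerivAt_id ξ).sub_const p).norm_sq).sqrt (by simpa using hn)
  simp only [id, Real.sqrt_sq (norm_nonneg _)] at h1
  refine h1.congr_fderiv ?_
  ext v
  simp
  field_simp

theorem hasFDerivAt_coord_sub (p ξ : E3) (j : Fin 3) :
    HasFDerivAt (fun η : E3 => η j - p j) (EuclideanSpace.proj j : E3 →L[ℝ] ℝ) ξ :=
  (EuclideanSpace.proj j : E3 →L[ℝ] ℝ).hasFDerivAt.sub_const (p j)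

theorem inner_single_one (v : E3) (i : Fin 3) :
    inner ℝ v (EuclideanSpace.single i (1 : ℝ)) = v i := by
  simp [EuclideanSpace.inner_single_right]

theorem hasFDerivAt_coord_sub_div_norm_sub {p ξ : E3} (h : ξ ≠ p) (j : Fin 3) :
    HasFDerivAt (fun η : E3 => (η j - p j) / ‖η - p‖)
      ((‖ξ - p‖ ^ 2)⁻¹ • (‖ξ - p‖ • (EuclideanSpace.proj j : E3 →L[ℝ] ℝ)
        - (ξ j - p j) • (‖ξ - p‖⁻¹ • innerSL ℝ (ξ - p)))) ξ := by
  have hn : ‖ξ - p‖ ≠ 0 := norm_ne_zero_iff.mpr (sub_ne_zero.mpr h)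
  have h1 := (hasFDerivAt_coord_sub p ξ j).mul
    ((hasDerivAt_inv hn).comp_hasFDerivAt ξ (hasFDerivAt_norm_sub h))
  refine HasFDerivAt.congr_fderiv (f := fun η : E3 => (η j - p j) / ‖η - p‖) h1 ?_
  ext v
  simp
  field_simp
  ring

theorem pd_norm_combination {p q ξ : E3} (μ : ℝ) (hp : ξ ≠ p) (hq : ξ ≠ q) (j : Fin 3) :
    pd j (fun η => (‖η - q‖ + μ * ‖η - p‖) / 2) ξ
      = ((ξ j - q j) / ‖ξ - q‖ + μ * ((ξ j - p j) / ‖ξ - p‖)) / 2 := by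
  have h := ((hasFDerivAt_norm_sub hq).fun_add
    ((hasFDerivAt_norm_sub hp).const_mul μ)).mul_const (2⁻¹ : ℝ)
  simp only [← div_eq_mul_inv] at h
  rw [pd, h.fderiv]
  simp only [FunLike.coe_smul, FunLike.coe_add, Pi.smul_apply, Pi.add_apply, smul_eq_mul,
    innerSL_apply_apply, inner_single_one, PiLp.sub_apply]
  ring

theorem pd_pd_norm_combination {p q ξ : E3} (μ : ℝ) (hp : ξ ≠ p) (hq : ξ ≠ q) (i j : Fin 3) :
    pd i (fun η => pd j (fun ζ => (‖ζ - q‖ + μ * ‖ζ - p‖) / 2) η) ξ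
      = (if i = j then (‖ξ - q‖⁻¹ + μ * ‖ξ - p‖⁻¹) / 2 else 0)
        - (‖ξ - q‖⁻¹ ^ 3 / 2) * (ξ i - q i) * (ξ j - q j)
        - (μ * ‖ξ - p‖⁻¹ ^ 3 / 2) * (ξ i - p i) * (ξ j - p j) := by
  have hnp : ‖ξ - p‖ ≠ 0 := norm_ne_zero_iff.mpr (sub_ne_zero.mpr hp)
  have hnq : ‖ξ - q‖ ≠ 0 := norm_ne_zero_iff.mpr (sub_ne_zero.mpr hq)
  have hev : (fun η => pd j (fun ζ => (‖ζ - q‖ + μ * ‖ζ - p‖) / 2) η) =ᶠ[nhds ξ]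
      fun η => ((η j - q j) / ‖η - q‖ + μ * ((η j - p j) / ‖η - p‖)) / 2 := by
    filter_upwards [isOpen_ne.mem_nhds hp, isOpen_ne.mem_nhds hq] with η h1 h2
    exact pd_norm_combination μ h1 h2 j
  have h := ((hasFDerivAt_coord_sub_div_norm_sub hq j).fun_add
    ((hasFDerivAt_coord_sub_div_norm_sub hp j).const_mul μ)).mul_const (2⁻¹ : ℝ)
  simp only [← div_eq_mul_inv] at h
  rw [pd_congr_of_eventuallyEq i hev, pd, h.fderiv]
  simp only [FunLike.coe_smul, FunLike.coe_add, FunLike.coe_sub, Pi.smul_apply, Pi.add_apply,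
    Pi.sub_apply, smul_eq_mul, innerSL_apply_apply, inner_single_one, PiLp.sub_apply,
    PiLp.proj_apply, PiLp.single_apply]
  rcases eq_or_ne i j with rfl | hij
  · simp only [if_true]
    field_simp
    ring
  · simp only [if_neg hij, if_neg hij.symm]
    field_simp
    ring

/-- Determinant of a rank-two perturbation of a scalar `3 × 3` matrix. -/
theorem det_scalar_sub_rank_one_sub_rank_one (s A B : ℝ) (v w : Fin 3 → ℝ) :
    (Matrix.of fun i j : Fin 3 => (if i = j then s else 0) - A * w i * w j - B * v i * v j).det
      = s ^ 3 - s ^ 2 * (A * (w ⬝ᵥ w) + B * (v ⬝ᵥ v))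
        + s * A * B * ((w ⬝ᵥ w) * (v ⬝ᵥ v) - (w ⬝ᵥ v) ^ 2) := by
  simp [Matrix.det_fin_three, dotProduct, Fin.sum_univ_three]
  ring

theorem d1_eq_norm_sub (κ : ℝ) (ξ : E3) : d1 κ ξ = ‖ξ - !₂[0, 0, κ⁻¹]‖ := by
  simp [d1, EuclideanSpace.norm_eq, Fin.sum_univ_three]

theorem d2_eq_norm_sub (κ : ℝ) (ξ : E3) : d2 κ ξ = ‖ξ - !₂[0, 0, -κ⁻¹]‖ := by
  simp [d2, EuclideanSpace.norm_eq, Fin.sum_univ_three]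

theorem d1_sq (κ : ℝ) (ξ : E3) :
    d1 κ ξ ^ 2 = (ξ 0) ^ 2 + (ξ 1) ^ 2 + (ξ 2 - κ⁻¹) ^ 2 :=
  Real.sq_sqrt (by positivity)

theorem d2_sq (κ : ℝ) (ξ : E3) :
    d2 κ ξ ^ 2 = (ξ 0) ^ 2 + (ξ 1) ^ 2 + (ξ 2 + κ⁻¹) ^ 2 :=
  Real.sq_sqrt (by positivity)

theorem ne_vec_of_not_coords {c : ℝ} {ξ : E3} (h : ¬(ξ 0 = 0 ∧ ξ 1 = 0 ∧ ξ 2 = c)) :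
    ξ ≠ !₂[0, 0, c] := by
  rintro rfl
  exact h (by simp)

/-- For `Λ = (d₂ + μd₁)/2` (`μ = ±1`, i.e. `Λ ∈ {Σ_κ, Ω_κ}`), `Λ` is smooth
away from the two singular points `(0,0,±κ⁻¹)`, and its Hessian determinant there equals
`κ⁻²(ξ₁² + ξ₂²)Λ/(d₁d₂)⁴`. -/
theorem hessian_determinant_dispersion_relation (κ μ : ℝ) (hκ : 0 < κ) (hμ : μ = 1 ∨ μ = -1) :
    let Λ : E3 → ℝ := fun ξ => (d2 κ ξ + μ * d1 κ ξ) / 2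
    let S : Set E3 := {ξ | ¬(ξ 0 = 0 ∧ ξ 1 = 0 ∧ ξ 2 = κ⁻¹) ∧ ¬(ξ 0 = 0 ∧ ξ 1 = 0 ∧ ξ 2 = -κ⁻¹)}
    ContDiffOn ℝ (⊤ : ℕ∞) Λ S ∧
    ∀ ξ ∈ S,
      (Matrix.of fun i j : Fin 3 => pd i (fun η => pd j Λ η) ξ).det
        = κ⁻¹ ^ 2 * ((ξ 0) ^ 2 + (ξ 1) ^ 2) * Λ ξ / (d1 κ ξ * d2 κ ξ) ^ 4 := by
  intro Λ S
  have hΛ : Λ = fun ζ => (‖ζ - !₂[0, 0, -κ⁻¹]‖ + μ * ‖ζ - !₂[0, 0, κ⁻¹]‖) / 2 := by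
    simp only [Λ, d1_eq_norm_sub, d2_eq_norm_sub]
  refine ⟨?_, ?_⟩
  · rintro ξ ⟨h1, h2⟩
    have h1' := sub_ne_zero.mpr (ne_vec_of_not_coords h1)
    have h2' := sub_ne_zero.mpr (ne_vec_of_not_coords h2)
    rw [hΛ]
    refine ContDiffAt.contDiffWithinAt ?_
    exact (((contDiffAt_id.sub contDiffAt_const).norm ℝ h2').add
      (contDiffAt_const.mul ((contDiffAt_id.sub contDiffAt_const).norm ℝ h1'))).div_const 2
  · rintro ξ ⟨h1, h2⟩
    have h1' := ne_vec_of_not_coords h1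
    have h2' := ne_vec_of_not_coords h2
    have ha : d1 κ ξ ≠ 0 := by
      rw [d1_eq_norm_sub]
      exact norm_ne_zero_iff.mpr (sub_ne_zero.mpr h1')
    have hb : d2 κ ξ ≠ 0 := by
      rw [d2_eq_norm_sub]
      exact norm_ne_zero_iff.mpr (sub_ne_zero.mpr h2')
    have hμ2 : μ ^ 2 = 1 := by rcases hμ with rfl | rfl <;> norm_num
    have hdet (i j : Fin 3) := pd_pd_norm_combination μ h1' h2' i j
    simp only [← d1_eq_norm_sub, ← d2_eq_norm_sub] at hdet
    simp only [Λ, hdet]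
    rw [det_scalar_sub_rank_one_sub_rank_one _ _ _ (fun i => ξ i - !₂[0, 0, κ⁻¹] i)
      (fun i => ξ i - !₂[0, 0, -κ⁻¹] i)]
    have hv : (fun i => ξ i - !₂[0, 0, κ⁻¹] i) ⬝ᵥ (fun i => ξ i - !₂[0, 0, κ⁻¹] i)
        = d1 κ ξ ^ 2 := by
      rw [d1_sq]
      simp [dotProduct, Fin.sum_univ_three]
      ring
    have hw : (fun i => ξ i - !₂[0, 0, -κ⁻¹] i) ⬝ᵥ (fun i => ξ i - !₂[0, 0, -κ⁻¹] i)
        = d2 κ ξ ^ 2 := by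
      rw [d2_sq]
      simp [dotProduct, Fin.sum_univ_three]
      ring
    have hgram : d2 κ ξ ^ 2 * d1 κ ξ ^ 2
        - ((fun i => ξ i - !₂[0, 0, -κ⁻¹] i) ⬝ᵥ (fun i => ξ i - !₂[0, 0, κ⁻¹] i)) ^ 2
        = 4 * κ⁻¹ ^ 2 * ((ξ 0) ^ 2 + (ξ 1) ^ 2) := by
      rw [d1_sq, d2_sq]
      simp only [dotProduct, Fin.sum_univ_three]
      simp
      ring
    rw [hv, hw, hgram]
    linear_combination (norm := (field_simp; ring))
      (κ⁻¹ ^ 2 * ((ξ 0) ^ 2 + (ξ 1) ^ 2) * d2 κ ξ / (2 * (d1 κ ξ * d2 κ ξ) ^ 4)) * hμ2
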